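/- arXiv:1512.01051 — 2 statements merged into one kernel-verified Lean document; each statement's English description precedes it below -/
import Mathlib

section
/- Sobolev–Hardy inequality: Let 0 ≤ s < 2 and q ∈ [2, 2(3−s)]. Then there exists a constant C = C(q,s) > 0 such that for all f ∈ C_c^∞(ℝ³), (∫_{ℝ³} |f(x)|^q / r(x)^s dx)^{1/q} ≤ C ‖f‖_{L²}^{(3−s)/q − 1/2} ‖∇f‖_{L²}^{3/2 − (3−s)/q}, where r(x) = √(x₁² + x₂²). -/
open MeasureTheory Real

/-- Distance to the `x₃`-axis in `ℝ³`. -/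
noncomputable def cylR (x : EuclideanSpace ℝ (Fin 3)) : ℝ :=
  Real.sqrt ((x 0) ^ 2 + (x 1) ^ 2)


namespace SobHardy

abbrev E3 := EuclideanSpace ℝ (Fin 3)

noncomputable def Wt (ε : ℝ) (x : E3) : ℝ := (x 0) ^ 2 + (x 1) ^ 2 + ε

lemma Wt_pos {ε : ℝ} (hε : 0 < ε) (x : E3) : 0 < Wt ε x := by
  unfold Wt; positivity

lemma Wt_cont (ε : ℝ) : Continuous (Wt ε) := by
  unfold Wt; fun_prop

lemma Wt_rpow_cont {ε : ℝ} (hε : 0 < ε) (a : ℝ) : Continuous (fun x => Wt ε x ^ a) :=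
  (Wt_cont ε).rpow_const (fun x => Or.inl (Wt_pos hε x).ne')

lemma interp {F G : E3 → ℝ} (hF : Integrable F) (hG : Integrable G)
    (hF0 : ∀ x, 0 ≤ F x) (hG0 : ∀ x, 0 ≤ G x) {p q : ℝ} (hp : 0 ≤ p) (hq : 0 ≤ q)
    (hpq : p + q = 1) :
    ∫ x, F x ^ p * G x ^ q ≤ (∫ x, F x) ^ p * (∫ x, G x) ^ q := by
  have h := ENNReal.lintegral_mul_norm_pow_le (μ := (volume : Measure E3))
    (f := fun x => ENNReal.ofReal (F x)) (g := fun x => ENNReal.ofReal (G x))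
    hF.aestronglyMeasurable.aemeasurable.ennreal_ofReal
    hG.aestronglyMeasurable.aemeasurable.ennreal_ofReal hp hq hpq
  rw [← ofReal_integral_eq_lintegral_ofReal hF (Filter.Eventually.of_forall hF0),
    ← ofReal_integral_eq_lintegral_ofReal hG (Filter.Eventually.of_forall hG0),
    ENNReal.ofReal_rpow_of_nonneg (integral_nonneg hF0) hp,
    ENNReal.ofReal_rpow_of_nonneg (integral_nonneg hG0) hq,
    ← ENNReal.ofReal_mul (Real.rpow_nonneg (integral_nonneg hF0) _)] at h
  have hm : AEStronglyMeasurable (fun x => F x ^ p * G x ^ q) (volume : Measure E3) :=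
    ((hF.aestronglyMeasurable.aemeasurable.pow_const p).mul
      (hG.aestronglyMeasurable.aemeasurable.pow_const q)).aestronglyMeasurable
  rw [integral_eq_lintegral_of_nonneg_ae (Filter.Eventually.of_forall fun x =>
    mul_nonneg (Real.rpow_nonneg (hF0 x) _) (Real.rpow_nonneg (hG0 x) _)) hm]
  apply ENNReal.toReal_le_of_le_ofReal
  · exact mul_nonneg (Real.rpow_nonneg (integral_nonneg hF0) _)
      (Real.rpow_nonneg (integral_nonneg hG0) _)
  · refine le_trans (le_of_eq ?_) h
    congr 1; ext x
    rw [ENNReal.ofReal_mul (Real.rpow_nonneg (hF0 x) _),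
      ENNReal.ofReal_rpow_of_nonneg (hF0 x) hp, ENNReal.ofReal_rpow_of_nonneg (hG0 x) hq]

lemma hcs_pow {f : E3 → ℝ} (hf : HasCompactSupport f) {q : ℝ} (hq : 0 < q) :
    HasCompactSupport (fun x => |f x| ^ q) := by
  refine hf.comp_left (g := fun y => |y| ^ q) ?_
  simp [hq.ne']

lemma int_w {f : E3 → ℝ} (hc : ContDiff ℝ (⊤ : ℕ∞) f) (hf : HasCompactSupport f)
    {q : ℝ} (hq : 0 < q) {h : E3 → ℝ} (hh : Continuous h) :
    Integrable (fun x => |f x| ^ q * h x) := by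
  apply Continuous.integrable_of_hasCompactSupport
  · exact (hc.continuous.abs.rpow_const (fun x => Or.inr hq.le)).mul hh
  · exact (hcs_pow hf hq).mul_right

lemma int_grad {f : E3 → ℝ} (hc : ContDiff ℝ (⊤ : ℕ∞) f) (hf : HasCompactSupport f) :
    Integrable (fun x => ‖fderiv ℝ f x‖ ^ 2) := by
  apply Continuous.integrable_of_hasCompactSupport
  · exact (hc.continuous_fderiv (by simp)).norm.pow 2
  · exact (hf.fderiv ℝ).comp_left (g := fun y => ‖y‖ ^ 2) (by simp)

lemma int_sq {f : E3 → ℝ} (hc : ContDiff ℝ (⊤ : ℕ∞) f) (hf : HasCompactSupport f) :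
    Integrable (fun x => (f x) ^ 2) := by
  apply Continuous.integrable_of_hasCompactSupport
  · exact hc.continuous.pow 2
  · exact hf.comp_left (g := fun y => y ^ 2) (by simp)

def P (s q : ℝ) : Prop :=
  ∃ C > (0 : ℝ), ∀ ε > (0 : ℝ), ∀ f : E3 → ℝ,
    ContDiff ℝ (⊤ : ℕ∞) f → HasCompactSupport f →
    ∫ x, |f x| ^ q * Wt ε x ^ (-s / 2) ≤
      C * (∫ x, (f x) ^ 2) ^ ((3 - s) / 2 - q / 4) *
        (∫ x, ‖fderiv ℝ f x‖ ^ 2) ^ (3 * q / 4 - (3 - s) / 2)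

/-- Sobolev. -/
lemma sob : ∃ C > (0 : ℝ), ∀ f : E3 → ℝ,
    ContDiff ℝ (⊤ : ℕ∞) f → HasCompactSupport f →
    ∫ x, |f x| ^ (6 : ℝ) ≤ C * (∫ x, ‖fderiv ℝ f x‖ ^ 2) ^ (3 : ℝ) := by
  set K := SNormLESNormFDerivOfEqConst ℝ (volume : Measure E3) ((2 : NNReal) : ℝ) with hK
  refine ⟨(K : ℝ) ^ (6 : ℝ) + 1, by positivity, fun f hc hf => ?_⟩
  have h := eLpNorm_le_eLpNorm_fderiv_of_eq (volume : Measure E3) (u := f)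
    (hc.of_le (by exact_mod_cast le_top)) hf (p := 2) (p' := 6) (by norm_num) (by simp)
    (by simp; norm_num)
  rw [← hK] at h
  have m1 : MemLp f ((6 : NNReal) : ENNReal) :=
    hc.continuous.memLp_of_hasCompactSupport hf
  have m2 : MemLp (fderiv ℝ f) ((2 : NNReal) : ENNReal) :=
    (hc.continuous_fderiv (by simp)).memLp_of_hasCompactSupport (hf.fderiv ℝ)
  rw [m1.eLpNorm_eq_integral_rpow_norm (by simp) (by simp),
    m2.eLpNorm_eq_integral_rpow_norm (by simp) (by simp)] at h
  have hB : 0 ≤ ∫ x, ‖fderiv ℝ f x‖ ^ 2 := integral_nonneg fun x => by positivity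
  have hI : 0 ≤ ∫ x, |f x| ^ (6 : ℝ) := integral_nonneg fun x => by positivity
  simp only [ENNReal.coe_toReal, NNReal.coe_ofNat, Real.rpow_two, Real.norm_eq_abs] at h
  rw [← ENNReal.ofReal_coe_nnreal, ← ENNReal.ofReal_mul (by positivity),
    ENNReal.ofReal_le_ofReal_iff (by positivity)] at h
  have h6 := Real.rpow_le_rpow (by positivity) h (show (0:ℝ) ≤ 6 by norm_num)
  rw [← Real.rpow_mul hI, Real.mul_rpow (by positivity) (by positivity), ← Real.rpow_mul hB] at h6
  norm_num at h6
  norm_num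
  refine h6.trans ?_
  gcongr
  linarith

end SobHardy

namespace SobHardy

lemma zeroP {q : ℝ} (h2 : 2 ≤ q) (h6 : q ≤ 6) : P 0 q := by
  obtain ⟨C, hC, H⟩ := sob
  set l := (q - 2) / 4 with hl
  have hl0 : 0 ≤ l := by rw [hl]; linarith
  have hl1 : 0 ≤ 1 - l := by rw [hl]; linarith
  have hq : q = 2 + 4 * l := by rw [hl]; ring
  refine ⟨C ^ l, by positivity, fun ε hε f hc hf => ?_⟩
  have hB : 0 ≤ ∫ x, ‖fderiv ℝ f x‖ ^ 2 := integral_nonneg fun x => by positivity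
  have hA : 0 ≤ ∫ x, (f x) ^ 2 := integral_nonneg fun x => by positivity
  have hI : 0 ≤ ∫ x, |f x| ^ (6 : ℝ) := integral_nonneg fun x => by positivity
  have i6 : Integrable (fun x => |f x| ^ (6 : ℝ)) := by
    simpa using int_w hc hf (q := 6) (by norm_num) (h := fun _ => 1) continuous_const
  have h := interp (int_sq hc hf) i6 (fun x => by positivity) (fun x => by positivity)
    hl1 hl0 (by ring)
  calc ∫ x, |f x| ^ q * Wt ε x ^ (-0 / 2 : ℝ)
      = ∫ x, (f x ^ 2) ^ (1 - l) * (|f x| ^ (6 : ℝ)) ^ l := by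
        congr 1; ext x
        rw [← sq_abs, ← Real.rpow_two, ← Real.rpow_mul (abs_nonneg _),
          ← Real.rpow_mul (abs_nonneg _), ← Real.rpow_add_of_nonneg (abs_nonneg _) (by positivity)
          (by positivity)]
        rw [show (-0 / 2 : ℝ) = 0 by norm_num, Real.rpow_zero, mul_one]
        congr 1; rw [hq]; ring
    _ ≤ _ := h
    _ ≤ (∫ x, (f x) ^ 2) ^ (1 - l) * (C * (∫ x, ‖fderiv ℝ f x‖ ^ 2) ^ (3 : ℝ)) ^ l := by
        gcongr
        exact H f hc hf
    _ = _ := by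
        rw [Real.mul_rpow (by positivity) (by positivity), ← Real.rpow_mul hB]
        rw [show (3 - 0) / 2 - q / 4 = 1 - l by rw [hq]; ring,
          show 3 * q / 4 - (3 - 0) / 2 = 3 * l by rw [hq]; ring]
        ring

lemma interpP {s t q : ℝ} (hs0 : 0 ≤ s) (hst : s < t) (ht : t < 2)
    (H : ∀ p, 2 ≤ p → p ≤ 2 * (3 - t) → P t p) (hq1 : 2 ≤ q) (hq2 : q ≤ 2 * (3 - s)) :
    P s q := by
  set l := (q - 2) / (4 - 2 * s) with hl
  have hs4 : 0 < 4 - 2 * s := by linarith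
  have hl0 : 0 ≤ l := div_nonneg (by linarith) hs4.le
  have hl1 : l ≤ 1 := by rw [hl, div_le_one hs4]; linarith
  have hq : q = 2 + l * (4 - 2 * s) := by rw [hl]; field_simp; ring
  have htp : 0 < t := by linarith
  set θ := s / t with hθ
  have hθ0 : 0 ≤ θ := by positivity
  have hθ1 : 0 ≤ 1 - θ := by rw [hθ, sub_nonneg, div_le_one htp]; linarith
  have hs : s = θ * t := by rw [hθ]; field_simp
  clear_value l θ
  set q0 := 2 + 4 * l with hq0
  set q1 := 2 + l * (4 - 2 * t) with hq1
  have hq0p : 0 < q0 := by positivity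
  have hq1p : 2 ≤ q1 := by rw [hq1]; nlinarith
  have hqq : q = (1 - θ) * q0 + θ * q1 := by rw [hq, hq0, hq1, hs]; ring
  obtain ⟨C0, hC0, H0⟩ := zeroP (q := q0) (by linarith) (by linarith)
  obtain ⟨C1, hC1, H1⟩ := H q1 hq1p (by nlinarith)
  clear_value q0 q1
  refine ⟨C0 ^ (1 - θ) * C1 ^ θ, by positivity, fun ε hε f hc hf => ?_⟩
  specialize H0 ε hε f hc hf
  specialize H1 ε hε f hc hf
  have hB : 0 ≤ ∫ x, ‖fderiv ℝ f x‖ ^ 2 := integral_nonneg fun x => by positivity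
  have hA : 0 ≤ ∫ x, (f x) ^ 2 := integral_nonneg fun x => by positivity
  have hW := fun x => Wt_pos hε x
  have n0 : ∀ x, 0 ≤ |f x| ^ q0 * Wt ε x ^ (-0 / 2 : ℝ) := fun x => by
    have := hW x; positivity
  have n1 : ∀ x, 0 ≤ |f x| ^ q1 * Wt ε x ^ (-t / 2 : ℝ) := fun x => by
    have := hW x; positivity
  have I0 : 0 ≤ ∫ x, |f x| ^ q0 * Wt ε x ^ (-0 / 2 : ℝ) := integral_nonneg n0
  have I1 : 0 ≤ ∫ x, |f x| ^ q1 * Wt ε x ^ (-t / 2 : ℝ) := integral_nonneg n1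
  have h := interp (int_w hc hf hq0p (Wt_rpow_cont hε (-0 / 2)))
    (int_w hc hf (q := q1) (by linarith) (Wt_rpow_cont hε (-t / 2))) n0 n1 hθ1 hθ0 (by ring)
  calc ∫ x, |f x| ^ q * Wt ε x ^ (-s / 2 : ℝ)
      = ∫ x, (|f x| ^ q0 * Wt ε x ^ (-0 / 2 : ℝ)) ^ (1 - θ) *
          (|f x| ^ q1 * Wt ε x ^ (-t / 2 : ℝ)) ^ θ := by
        congr 1; ext x
        have w := (hW x).le
        rw [Real.mul_rpow (by positivity) (by positivity),
          Real.mul_rpow (by positivity) (by positivity), ← Real.rpow_mul (abs_nonneg _),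
          ← Real.rpow_mul (abs_nonneg _), ← Real.rpow_mul w, ← Real.rpow_mul w,
          hqq, Real.rpow_add_of_nonneg (abs_nonneg _) (by positivity) (by positivity)]
        rw [show (-0 / 2 * (1 - θ) : ℝ) = 0 by ring, Real.rpow_zero, mul_one,
          show -s / 2 = -t / 2 * θ by rw [hs]; ring, mul_comm q0, mul_comm q1]
        ring
    _ ≤ _ := h
    _ ≤ _ := mul_le_mul (Real.rpow_le_rpow I0 H0 hθ1) (Real.rpow_le_rpow I1 H1 hθ0)
        (by positivity) (by positivity)
    _ = _ := by
        have a0 : 0 ≤ (3 - 0) / 2 - q0 / 4 := by linarith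
        have a1 : 0 ≤ (3 - t) / 2 - q1 / 4 := by nlinarith
        have b0 : 0 ≤ 3 * q0 / 4 - (3 - 0) / 2 := by linarith
        have b1 : 0 ≤ 3 * q1 / 4 - (3 - t) / 2 := by linarith
        rw [Real.mul_rpow (by positivity) (by positivity),
          Real.mul_rpow (by positivity) (by positivity),
          Real.mul_rpow (by positivity) (by positivity),
          Real.mul_rpow (by positivity) (by positivity),
          ← Real.rpow_mul hA, ← Real.rpow_mul hA, ← Real.rpow_mul hB, ← Real.rpow_mul hB]
        rw [show (3 - s) / 2 - q / 4 = ((3 - 0) / 2 - q0 / 4) * (1 - θ) +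
            ((3 - t) / 2 - q1 / 4) * θ by rw [hqq, hs]; ring,
          show 3 * q / 4 - (3 - s) / 2 = (3 * q0 / 4 - (3 - 0) / 2) * (1 - θ) +
            (3 * q1 / 4 - (3 - t) / 2) * θ by rw [hqq, hs]; ring,
          Real.rpow_add_of_nonneg hA (by positivity) (by positivity),
          Real.rpow_add_of_nonneg hB (by positivity) (by positivity)]
        ring

lemma ibp {s q : ℝ} (hq : 2 ≤ q) {ε : ℝ} (hε : 0 < ε) {f : E3 → ℝ}
    (hc : ContDiff ℝ (⊤ : ℕ∞) f) (hf : HasCompactSupport f) (i : Fin 3) (hi : i = 0 ∨ i = 1) :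
    ∫ x, |f x| ^ q * (Wt ε x ^ (-s / 2) - s * (x i) ^ 2 * Wt ε x ^ (-s / 2 - 1)) =
      - ∫ x, (q * |f x| ^ (q - 2) * f x * fderiv ℝ f x (EuclideanSpace.single i 1)) *
        (x i * Wt ε x ^ (-s / 2)) := by
  have hW := fun x => Wt_pos hε x
  have c1 : Continuous fun x : E3 => x i * Wt ε x ^ (-s / 2) :=
    (by fun_prop : Continuous fun x : E3 => x i).mul (Wt_rpow_cont hε _)
  refine integral_bilinear_hasLineDerivAt_right_eq_neg_left_of_integrable
    (B := ContinuousLinearMap.mul ℝ ℝ) (f := fun x => |f x| ^ q)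
    (g := fun x => x i * Wt ε x ^ (-s / 2))
    (f' := fun x => q * |f x| ^ (q - 2) * f x * fderiv ℝ f x (EuclideanSpace.single i 1))
    (g' := fun x => Wt ε x ^ (-s / 2) - s * (x i) ^ 2 * Wt ε x ^ (-s / 2 - 1))
    (v := EuclideanSpace.single i 1) ?_ ?_ ?_ ?_ ?_
  · apply Continuous.integrable_of_hasCompactSupport
    · refine Continuous.mul (Continuous.mul (Continuous.mul (continuous_const.mul
        (hc.continuous.abs.rpow_const (fun x => Or.inr (by linarith)))) hc.continuous) ?_) c1
      exact (hc.continuous_fderiv (by simp)).clm_apply continuous_const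
    · exact ((hf.mul_left (f := fun x => q * |f x| ^ (q - 2))).mul_right).mul_right
  · refine int_w hc hf (by linarith) ((Wt_rpow_cont hε _).sub ?_)
    exact (by fun_prop : Continuous fun x : E3 => s * (x i) ^ 2).mul (Wt_rpow_cont hε _)
  · exact int_w hc hf (by linarith) c1
  · intro x _
    have h1 := (hc.differentiable (by simp) x).hasFDerivAt
    have h2 := (hasDerivAt_abs_rpow (f x) (p := q) (by linarith)).comp_hasFDerivAt x h1
    have h3 := h2.hasLineDerivAt (EuclideanSpace.single i 1)
    exact h3
  · intro x _
    unfold HasLineDerivAt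
    have e1 : HasDerivAt (fun t : ℝ => (x + t • EuclideanSpace.single i (1 : ℝ)) i) 1 0 := by
      simpa using (hasDerivAt_id (0 : ℝ)).const_add (x i)
    have e2 : HasDerivAt (fun t : ℝ => Wt ε (x + t • EuclideanSpace.single i (1 : ℝ)))
        (2 * x i) 0 := by
      rcases hi with rfl | rfl
      · have := ((((hasDerivAt_id (0 : ℝ)).const_add (x 0)).pow 2).add_const ((x 1) ^ 2)).add_const ε
        simpa [Wt] using this
      · have := ((((hasDerivAt_id (0 : ℝ)).const_add (x 1)).pow 2).const_add ((x 0) ^ 2)).add_const ε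
        simpa [Wt] using this
    have h0 : Wt ε (x + (0 : ℝ) • EuclideanSpace.single i (1 : ℝ)) ≠ 0 := (hW _).ne'
    have e3 := e1.mul (e2.rpow_const (p := -s / 2) (Or.inl h0))
    convert! e3 using 1
    simp
    ring

lemma stepP {t q : ℝ} (ht0 : 0 ≤ t) (ht : t < 2)
    (H : ∀ p, 2 ≤ p → p ≤ 2 * (3 - t) → P t p) (hq1 : 2 ≤ q) (hq2 : q ≤ 2 * (3 - (1 + t / 2))) :
    P (1 + t / 2) q := by
  obtain ⟨C, hC, H⟩ := H (2 * q - 2) (by linarith) (by linarith)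
  set s := 1 + t / 2 with hs
  have hs2 : 0 < 2 - s := by linarith
  refine ⟨(2 - s)⁻¹ * (2 * q) * C ^ (1 / 2 : ℝ), by positivity, fun ε hε f hc hf => ?_⟩
  specialize H ε hε f hc hf
  have hB : 0 ≤ ∫ x, ‖fderiv ℝ f x‖ ^ 2 := integral_nonneg fun x => by positivity
  have hA : 0 ≤ ∫ x, (f x) ^ 2 := integral_nonneg fun x => by positivity
  have hW := fun x => Wt_pos hε x
  have n1 : ∀ x, 0 ≤ |f x| ^ (2 * q - 2) * Wt ε x ^ (-t / 2 : ℝ) := fun x => by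
    have := hW x; positivity
  have I1 : 0 ≤ ∫ x, |f x| ^ (2 * q - 2) * Wt ε x ^ (-t / 2 : ℝ) := integral_nonneg n1
  have h := interp (int_grad hc hf)
    (int_w hc hf (q := 2 * q - 2) (by linarith) (Wt_rpow_cont hε (-t / 2)))
    (fun x => by positivity) n1 (p := 1 / 2) (q := 1 / 2) (by norm_num) (by norm_num) (by norm_num)
  have eqG : ∀ x, (‖fderiv ℝ f x‖ ^ 2) ^ (1 / 2 : ℝ) *
      (|f x| ^ (2 * q - 2) * Wt ε x ^ (-t / 2 : ℝ)) ^ (1 / 2 : ℝ) =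
      |f x| ^ (q - 1) * (‖fderiv ℝ f x‖ * Wt ε x ^ (-t / 4)) := by
    intro x
    have w := (hW x).le
    rw [Real.mul_rpow (by positivity) (by positivity), ← Real.rpow_two,
      ← Real.rpow_mul (norm_nonneg _), ← Real.rpow_mul (abs_nonneg _), ← Real.rpow_mul w,
      show (2 * (1 / 2) : ℝ) = 1 by norm_num, Real.rpow_one,
      show (2 * q - 2) * (1 / 2) = q - 1 by ring, show -t / 2 * (1 / 2) = -t / 4 by ring]
    ring
  simp only [eqG] at h
  have cG : Continuous fun x => ‖fderiv ℝ f x‖ * Wt ε x ^ (-t / 4) :=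
    (hc.continuous_fderiv (by simp)).norm.mul (Wt_rpow_cont hε _)
  have iG := int_w hc hf (q := q - 1) (by linarith) cG
  have iL := int_w hc hf (q := q) (by linarith) (Wt_rpow_cont hε (-s / 2))
  have cD : ∀ i : Fin 3, Continuous
      fun x : E3 => Wt ε x ^ (-s / 2) - s * (x i) ^ 2 * Wt ε x ^ (-s / 2 - 1) := fun i =>
    (Wt_rpow_cont hε _).sub
      ((by fun_prop : Continuous fun x : E3 => s * (x i) ^ 2).mul (Wt_rpow_cont hε _))
  have iD := fun i => int_w hc hf (q := q) (by linarith) (cD i)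
  -- lower bound
  have low : (2 - s) * ∫ x, |f x| ^ q * Wt ε x ^ (-s / 2) ≤
      (∫ x, |f x| ^ q * (Wt ε x ^ (-s / 2) - s * (x 0) ^ 2 * Wt ε x ^ (-s / 2 - 1))) +
      ∫ x, |f x| ^ q * (Wt ε x ^ (-s / 2) - s * (x 1) ^ 2 * Wt ε x ^ (-s / 2 - 1)) := by
    rw [← integral_add (iD 0) (iD 1), ← integral_const_mul]
    refine integral_mono (iL.const_mul _) ((iD 0).add (iD 1)) fun x => ?_
    have w := hW x
    have e : Wt ε x ^ (-s / 2) = Wt ε x * Wt ε x ^ (-s / 2 - 1) := by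
      rw [Real.rpow_sub_one w.ne']; field_simp
    have e2 : (x 0) ^ 2 + (x 1) ^ 2 ≤ Wt ε x := by unfold Wt; linarith
    have hz : 0 ≤ |f x| ^ q * Wt ε x ^ (-s / 2 - 1) := by positivity
    have := mul_nonneg (mul_nonneg (by linarith : 0 ≤ s) hz) (sub_nonneg.2 e2)
    simp only [Pi.add_apply]
    rw [e]
    nlinarith
  -- upper bound
  have up : ∀ i : Fin 3, (i = 0 ∨ i = 1) →
      ∫ x, |f x| ^ q * (Wt ε x ^ (-s / 2) - s * (x i) ^ 2 * Wt ε x ^ (-s / 2 - 1)) ≤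
      q * ∫ x, |f x| ^ (q - 1) * (‖fderiv ℝ f x‖ * Wt ε x ^ (-t / 4)) := by
    intro i hi
    rw [ibp hq1 hε hc hf i hi, ← integral_const_mul]
    refine (neg_le_abs _).trans ?_
    rw [← Real.norm_eq_abs]
    refine norm_integral_le_of_norm_le (iG.const_mul _) (Filter.Eventually.of_forall fun x => ?_)
    have w := hW x
    have b1 : |fderiv ℝ f x (EuclideanSpace.single i 1)| ≤ ‖fderiv ℝ f x‖ := by
      simpa using (fderiv ℝ f x).le_opNorm (EuclideanSpace.single i 1)
    have b2 : |x i| ≤ Wt ε x ^ (1 / 2 : ℝ) := by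
      rw [← Real.sqrt_eq_rpow]
      apply Real.abs_le_sqrt
      unfold Wt
      rcases hi with rfl | rfl <;> nlinarith [sq_nonneg (x 0), sq_nonneg (x 1)]
    have e1 : |f x| ^ (q - 1) = |f x| ^ (q - 2) * |f x| := by
      rw [show q - 1 = (q - 2) + 1 by ring, Real.rpow_add_of_nonneg (abs_nonneg _) (by linarith)
        (by norm_num), Real.rpow_one]
    have e2 : Wt ε x ^ (-t / 4) = Wt ε x ^ (1 / 2 : ℝ) * Wt ε x ^ (-s / 2) := by
      rw [← Real.rpow_add w]; congr 1; rw [hs]; ring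
    rw [Real.norm_eq_abs]
    simp only [abs_mul]
    rw [abs_of_nonneg (by linarith : 0 ≤ q), abs_of_nonneg (Real.rpow_nonneg (abs_nonneg (f x)) _),
      abs_of_nonneg (Real.rpow_nonneg w.le (-s / 2)), e1, e2]
    calc _ ≤ q * |f x| ^ (q - 2) * |f x| * ‖fderiv ℝ f x‖ *
          (Wt ε x ^ (1 / 2 : ℝ) * Wt ε x ^ (-s / 2)) := by gcongr
      _ = _ := by ring
  have u0 := up 0 (Or.inl rfl)
  have u1 := up 1 (Or.inr rfl)
  have a1 : 0 ≤ (3 - t) / 2 - (2 * q - 2) / 4 := by linarith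
  have key : ∫ x, |f x| ^ (q - 1) * (‖fderiv ℝ f x‖ * Wt ε x ^ (-t / 4)) ≤
      C ^ (1 / 2 : ℝ) * (∫ x, (f x) ^ 2) ^ ((3 - s) / 2 - q / 4) *
        (∫ x, ‖fderiv ℝ f x‖ ^ 2) ^ (3 * q / 4 - (3 - s) / 2) := by
    refine h.trans ((mul_le_mul_of_nonneg_left
      (Real.rpow_le_rpow I1 H (by norm_num)) (by positivity)).trans (le_of_eq ?_))
    rw [Real.mul_rpow (by positivity) (by positivity),
      Real.mul_rpow (by positivity) (by positivity), ← Real.rpow_mul hA, ← Real.rpow_mul hB]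
    rw [show (3 - s) / 2 - q / 4 = ((3 - t) / 2 - (2 * q - 2) / 4) * (1 / 2) by rw [hs]; ring,
      show 3 * q / 4 - (3 - s) / 2 = 1 / 2 + (3 * (2 * q - 2) / 4 - (3 - t) / 2) * (1 / 2) by
        rw [hs]; ring, Real.rpow_add_of_nonneg hB (by norm_num) (by linarith)]
    ring
  rw [show ∀ a b : ℝ, (2 - s)⁻¹ * (2 * q) * C ^ (1 / 2 : ℝ) * a * b =
    (2 * q * (C ^ (1 / 2 : ℝ) * a * b)) / (2 - s) by intros; field_simp, le_div_iff₀' hs2]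
  nlinarith

lemma seqP (n : ℕ) : ∀ p, 2 ≤ p → p ≤ 2 * (3 - (2 - 2 * (1 / 2 : ℝ) ^ n)) →
    P (2 - 2 * (1 / 2 : ℝ) ^ n) p := by
  induction n with
  | zero =>
    intro p h1 h2
    norm_num at h2 ⊢
    exact zeroP h1 h2
  | succ n ih =>
    intro p h1 h2
    have e : 2 - 2 * (1 / 2 : ℝ) ^ (n + 1) = 1 + (2 - 2 * (1 / 2 : ℝ) ^ n) / 2 := by
      rw [pow_succ]; ring
    rw [e] at h2 ⊢
    have : (1 / 2 : ℝ) ^ n ≤ 1 := pow_le_one₀ (by norm_num) (by norm_num)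
    have h0 : 0 < (1 / 2 : ℝ) ^ n := by positivity
    exact stepP (by linarith) (by linarith) ih h1 h2

lemma allP {s q : ℝ} (hs0 : 0 ≤ s) (hs2 : s < 2) (hq1 : 2 ≤ q) (hq2 : q ≤ 2 * (3 - s)) :
    P s q := by
  obtain ⟨n, hn⟩ := exists_pow_lt_of_lt_one (show 0 < (2 - s) / 2 by linarith)
    (show (1 / 2 : ℝ) < 1 by norm_num)
  have h0 : 0 < (1 / 2 : ℝ) ^ n := by positivity
  exact interpP hs0 (by linarith) (by linarith) (seqP n) hq1 hq2

lemma ptwise {s q : ℝ} (hs0 : 0 ≤ s) (f : E3 → ℝ) (x : E3) :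
    ENNReal.ofReal (|f x| ^ q / cylR x ^ s) ≤
      Filter.liminf (fun n : ℕ => ENNReal.ofReal (|f x| ^ q * Wt (1 / ((n : ℝ) + 1)) x ^ (-s / 2)))
        Filter.atTop := by
  by_cases h : (x 0) ^ 2 + (x 1) ^ 2 = 0
  · rcases hs0.eq_or_lt with rfl | hs
    · simp
    · simp [cylR, h, Real.zero_rpow hs.ne']
  · have hp : 0 < (x 0) ^ 2 + (x 1) ^ 2 := lt_of_le_of_ne (by positivity) (Ne.symm h)
    have e : |f x| ^ q / cylR x ^ s = |f x| ^ q * ((x 0) ^ 2 + (x 1) ^ 2 + 0) ^ (-s / 2) := by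
      rw [cylR, Real.sqrt_eq_rpow, ← Real.rpow_mul hp.le, add_zero, div_eq_mul_inv,
        ← Real.rpow_neg hp.le]
      congr 2; ring
    rw [e]
    refine (Filter.Tendsto.liminf_eq ?_).ge
    apply ENNReal.tendsto_ofReal
    apply Filter.Tendsto.const_mul
    refine Filter.Tendsto.rpow_const (Filter.Tendsto.const_add _
      tendsto_one_div_add_atTop_nhds_zero_nat) (Or.inl (by simpa using h))

end SobHardy

open SobHardy in
/-- **Sobolev–Hardy inequality**: for `0 ≤ s < 2` and `q ∈ [2, 2(3-s)]` there is a constant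
`C = C(q, s) > 0` such that for every `f ∈ C_c^∞(ℝ³)`,
`(∫ |f|^q / r^s)^{1/q} ≤ C ‖f‖_{L²}^{(3-s)/q - 1/2} ‖∇f‖_{L²}^{3/2 - (3-s)/q}`. -/
theorem sobolev_hardy (s q : ℝ) (hs0 : 0 ≤ s) (hs2 : s < 2)
    (hq1 : 2 ≤ q) (hq2 : q ≤ 2 * (3 - s)) :
    ∃ C > (0 : ℝ), ∀ f : EuclideanSpace ℝ (Fin 3) → ℝ,
      ContDiff ℝ (⊤ : ℕ∞) f → HasCompactSupport f →
      (∫ x, |f x| ^ q / (cylR x) ^ s) ^ (1 / q) ≤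
        C * ((∫ x, (f x) ^ 2) ^ ((1 : ℝ) / 2)) ^ ((3 - s) / q - 1 / 2)
          * ((∫ x, ‖fderiv ℝ f x‖ ^ 2) ^ ((1 : ℝ) / 2)) ^ ((3 : ℝ) / 2 - (3 - s) / q) := by
  obtain ⟨C, hC, H⟩ := allP hs0 hs2 hq1 hq2
  refine ⟨C ^ (1 / q), by positivity, fun f hc hf => ?_⟩
  have hB : 0 ≤ ∫ x, ‖fderiv ℝ f x‖ ^ 2 := integral_nonneg fun x => by positivity
  have hA : 0 ≤ ∫ x, (f x) ^ 2 := integral_nonneg fun x => by positivity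
  have hr : ∀ x, 0 ≤ cylR x := fun x => Real.sqrt_nonneg _
  have hn : ∀ x, 0 ≤ |f x| ^ q / (cylR x) ^ s := fun x => by have := hr x; positivity
  set R := C * (∫ x, (f x) ^ 2) ^ ((3 - s) / 2 - q / 4) *
        (∫ x, ‖fderiv ℝ f x‖ ^ 2) ^ (3 * q / 4 - (3 - s) / 2) with hR
  have hR0 : 0 ≤ R := by positivity
  have mr : Measurable cylR := by
    have : Continuous cylR := by unfold cylR; fun_prop
    exact this.measurable
  have main : ∫ x, |f x| ^ q / (cylR x) ^ s ≤ R := by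
    rw [integral_eq_lintegral_of_nonneg_ae (Filter.Eventually.of_forall hn)
      (((hc.continuous.abs.measurable.pow_const q).div (mr.pow_const s)).aestronglyMeasurable)]
    apply ENNReal.toReal_le_of_le_ofReal hR0
    refine (lintegral_mono fun x => ptwise hs0 f x).trans ?_
    have hε : ∀ n : ℕ, 0 < 1 / ((n : ℝ) + 1) := fun n => by positivity
    have hI := fun n : ℕ =>
      int_w hc hf (q := q) (by linarith) (Wt_rpow_cont (hε n) (-s / 2))
    refine (lintegral_liminf_le' fun n =>
      (hI n).aestronglyMeasurable.aemeasurable.ennreal_ofReal).trans ?_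
    refine Filter.liminf_le_of_le (by isBoundedDefault) fun b hb => ?_
    obtain ⟨n, hn⟩ := hb.exists
    refine hn.trans ?_
    rw [← ofReal_integral_eq_lintegral_ofReal (hI n) (Filter.Eventually.of_forall fun x => by
      have := Wt_pos (hε n) x
      positivity)]
    exact ENNReal.ofReal_le_ofReal (H _ (hε n) f hc hf)
  have hq0 : 0 < q := by linarith
  refine (Real.rpow_le_rpow (integral_nonneg hn) main (by positivity)).trans (le_of_eq ?_)
  rw [hR, Real.mul_rpow (by positivity) (by positivity),
    Real.mul_rpow (by positivity) (by positivity), ← Real.rpow_mul hA, ← Real.rpow_mul hB,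
    ← Real.rpow_mul hA, ← Real.rpow_mul hB]
  rw [show ((3 - s) / 2 - q / 4) * (1 / q) = 1 / 2 * ((3 - s) / q - 1 / 2) by field_simp; ring,
    show (3 * q / 4 - (3 - s) / 2) * (1 / q) = 1 / 2 * (3 / 2 - (3 - s) / q) by field_simp; ring]
end

section
/- Interpolation bound for the second radial derivatives of (u^r, u³): for an axisymmetric divergence-free smooth decaying vector field u on ℝ³ with vorticity components ω^θ = ∂₃u^r − ∂_r u³ and Γ = ω^θ/r, there is a constant C such that ‖∇̃∇̃ (u^r, u³)‖_{L²} ≤ C (‖∇ω^θ‖_{L²} + ‖Γ‖_{L²}), where ∇̃ = (∂_r, ∂₃), using the identities Δu³ = −∂_rω^θ − Γ, ∂₃u^r = ω^θ + ∂_ru³, ∂_ru^r = −∂₃u³ − u^r/r, and ‖∇̃(u^r/r)‖_{L²} ≤ C‖Γ‖_{L²}. -/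
open MeasureTheory

/-- Partial derivative in `r` of a function of `(r, x₃)`. -/
noncomputable def pdr (f : ℝ → ℝ → ℝ) (r z : ℝ) : ℝ := deriv (fun r' => f r' z) r

/-- Partial derivative in `x₃` of a function of `(r, x₃)`. -/
noncomputable def pdz (f : ℝ → ℝ → ℝ) (r z : ℝ) : ℝ := deriv (fun z' => f r z') z

/-- Squared Frobenius norm of the 2D Hessian `∇̃∇̃ f`, `∇̃ = (∂_r, ∂₃)`. -/
noncomputable def hessSq (f : ℝ → ℝ → ℝ) (r z : ℝ) : ℝ :=
  (pdr (pdr f) r z) ^ 2 + (pdz (pdr f) r z) ^ 2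
    + (pdr (pdz f) r z) ^ 2 + (pdz (pdz f) r z) ^ 2

/-- The half-plane `(0,∞) × ℝ` of cylindrical coordinates `(r, x₃)`. -/
def halfPlane : Set (ℝ × ℝ) := Set.Ioi 0 ×ˢ Set.univ


open Set Filter Topology

/-- The open half plane. -/
def HH : Set (ℝ × ℝ) := {p : ℝ × ℝ | 0 < p.1}

/-- smooth on the half plane -/
def Sm (f : ℝ → ℝ → ℝ) : Prop := ContDiffOn ℝ (⊤ : ℕ∞) (fun p : ℝ × ℝ => f p.1 p.2) HH

lemma HH_open : IsOpen HH := isOpen_lt continuous_const continuous_fst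

lemma halfPlane_eq : halfPlane = HH := by
  ext p; simp [halfPlane, HH]

lemma Sm.at {f : ℝ → ℝ → ℝ} (hf : Sm f) {r z : ℝ} (hr : 0 < r) :
    ContDiffAt ℝ (⊤ : ℕ∞) (fun p : ℝ × ℝ => f p.1 p.2) (r, z) :=
  ContDiffOn.contDiffAt hf (HH_open.mem_nhds hr)

lemma Sm.fd {f : ℝ → ℝ → ℝ} (hf : Sm f) {r z : ℝ} (hr : 0 < r) :
    HasFDerivAt (fun p : ℝ × ℝ => f p.1 p.2)
      (fderiv ℝ (fun p : ℝ × ℝ => f p.1 p.2) (r, z)) (r, z) :=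
  ((hf.at hr).differentiableAt (by simp)).hasFDerivAt

lemma hasDerivAt_r_of {f : ℝ → ℝ → ℝ} {L : ℝ × ℝ →L[ℝ] ℝ} {r z : ℝ}
    (h : HasFDerivAt (fun p : ℝ × ℝ => f p.1 p.2) L (r, z)) :
    HasDerivAt (fun r' => f r' z) (L (1, 0)) r := by
  have h2 : HasDerivAt (fun r' : ℝ => (r', z)) ((1 : ℝ), (0 : ℝ)) r :=
    (hasDerivAt_id r).prodMk (hasDerivAt_const r z)
  exact h.comp_hasDerivAt r h2

lemma hasDerivAt_z_of {f : ℝ → ℝ → ℝ} {L : ℝ × ℝ →L[ℝ] ℝ} {r z : ℝ}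
    (h : HasFDerivAt (fun p : ℝ × ℝ => f p.1 p.2) L (r, z)) :
    HasDerivAt (fun z' => f r z') (L (0, 1)) z := by
  have h2 : HasDerivAt (fun z' : ℝ => (r, z')) ((0 : ℝ), (1 : ℝ)) z :=
    (hasDerivAt_const z r).prodMk (hasDerivAt_id z)
  exact h.comp_hasDerivAt z h2

lemma Sm.pdr_eq {f : ℝ → ℝ → ℝ} (hf : Sm f) {r z : ℝ} (hr : 0 < r) :
    pdr f r z = fderiv ℝ (fun p : ℝ × ℝ => f p.1 p.2) (r, z) (1, 0) :=
  (hasDerivAt_r_of (hf.fd hr)).deriv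

lemma Sm.pdz_eq {f : ℝ → ℝ → ℝ} (hf : Sm f) {r z : ℝ} (hr : 0 < r) :
    pdz f r z = fderiv ℝ (fun p : ℝ × ℝ => f p.1 p.2) (r, z) (0, 1) :=
  (hasDerivAt_z_of (hf.fd hr)).deriv

lemma Sm.dr {f : ℝ → ℝ → ℝ} (hf : Sm f) {r z : ℝ} (hr : 0 < r) :
    HasDerivAt (fun r' => f r' z) (pdr f r z) r := by
  rw [hf.pdr_eq hr]; exact hasDerivAt_r_of (hf.fd hr)

lemma Sm.dz {f : ℝ → ℝ → ℝ} (hf : Sm f) {r z : ℝ} (hr : 0 < r) :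
    HasDerivAt (fun z' => f r z') (pdz f r z) z := by
  rw [hf.pdz_eq hr]; exact hasDerivAt_z_of (hf.fd hr)

lemma Sm.fderiv_smooth {f : ℝ → ℝ → ℝ} (hf : Sm f) :
    ContDiffOn ℝ (⊤ : ℕ∞) (fderiv ℝ (fun p : ℝ × ℝ => f p.1 p.2)) HH :=
  ContDiffOn.fderiv_of_isOpen hf HH_open (by simp)

lemma Sm.pdr {f : ℝ → ℝ → ℝ} (hf : Sm f) : Sm (pdr f) := by
  have h := hf.fderiv_smooth.clm_apply (contDiffOn_const (c := ((1 : ℝ), (0 : ℝ))))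
  exact h.congr (fun p hp => hf.pdr_eq hp)

lemma Sm.pdz {f : ℝ → ℝ → ℝ} (hf : Sm f) : Sm (pdz f) := by
  have h := hf.fderiv_smooth.clm_apply (contDiffOn_const (c := ((0 : ℝ), (1 : ℝ))))
  exact h.congr (fun p hp => hf.pdz_eq hp)

lemma Sm.comm {f : ℝ → ℝ → ℝ} (hf : Sm f) {r z : ℝ} (hr : 0 < r) :
    _root_.pdz (_root_.pdr f) r z = _root_.pdr (_root_.pdz f) r z := by
  have hs : IsSymmSndFDerivAt ℝ (fun p : ℝ × ℝ => f p.1 p.2) (r, z) :=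
    (hf.at hr).isSymmSndFDerivAt (by simp; exact WithTop.coe_le_coe.2 le_top)
  have hd : HasFDerivAt (fderiv ℝ (fun p : ℝ × ℝ => f p.1 p.2))
      (fderiv ℝ (fderiv ℝ (fun p : ℝ × ℝ => f p.1 p.2)) (r, z)) (r, z) :=
    ((hf.fderiv_smooth.contDiffAt (HH_open.mem_nhds hr)).differentiableAt (by simp)).hasFDerivAt
  have e1 : (fun p : ℝ × ℝ => _root_.pdr f p.1 p.2) =ᶠ[𝓝 (r, z)]
      fun p => fderiv ℝ (fun p : ℝ × ℝ => f p.1 p.2) p (1, 0) := by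
    filter_upwards [HH_open.mem_nhds hr] with p hp using hf.pdr_eq hp
  have e2 : (fun p : ℝ × ℝ => _root_.pdz f p.1 p.2) =ᶠ[𝓝 (r, z)]
      fun p => fderiv ℝ (fun p : ℝ × ℝ => f p.1 p.2) p (0, 1) := by
    filter_upwards [HH_open.mem_nhds hr] with p hp using hf.pdz_eq hp
  rw [hf.pdr.pdz_eq hr, hf.pdz.pdr_eq hr, e1.fderiv_eq, e2.fderiv_eq,
    (hd.clm_apply (hasFDerivAt_const ((1 : ℝ), (0 : ℝ)) (r, z))).fderiv,
    (hd.clm_apply (hasFDerivAt_const ((0 : ℝ), (1 : ℝ)) (r, z))).fderiv]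
  simpa using hs (0, 1) (1, 0)

lemma Sm.mul {f g : ℝ → ℝ → ℝ} (hf : Sm f) (hg : Sm g) : Sm (fun r z => f r z * g r z) :=
  ContDiffOn.mul hf hg

lemma Sm.sub {f g : ℝ → ℝ → ℝ} (hf : Sm f) (hg : Sm g) : Sm (fun r z => f r z - g r z) :=
  ContDiffOn.sub hf hg

lemma Sm.id : Sm (fun r _ => r) := contDiff_fst.contDiffOn

lemma Sm.div_r {f : ℝ → ℝ → ℝ} (hf : Sm f) : Sm (fun r z => f r z / r) :=
  ContDiffOn.div hf Sm.id (fun _ hp => ne_of_gt hp)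

lemma Sm.cont {f : ℝ → ℝ → ℝ} (hf : Sm f) : ContinuousOn (fun p : ℝ × ℝ => f p.1 p.2) HH :=
  ContDiffOn.continuousOn hf

/-- vanishing outside `K` in the half plane -/
def Vs (K : Set (ℝ × ℝ)) (f : ℝ → ℝ → ℝ) : Prop := ∀ r z, 0 < r → (r, z) ∉ K → f r z = 0

lemma Vs.ev {K : Set (ℝ × ℝ)} (hK : IsClosed K) {f : ℝ → ℝ → ℝ} (hf : Vs K f) {r z : ℝ}
    (hr : 0 < r) (h : (r, z) ∉ K) : ∀ᶠ p : ℝ × ℝ in 𝓝 (r, z), f p.1 p.2 = 0 := by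
  filter_upwards [HH_open.mem_nhds hr, hK.isOpen_compl.mem_nhds h] with p h1 h2 using hf _ _ h1 h2

lemma Vs.pdr {K : Set (ℝ × ℝ)} (hK : IsClosed K) {f : ℝ → ℝ → ℝ} (hf : Vs K f) :
    Vs K (pdr f) := by
  intro r z hr h
  have h1 : Tendsto (fun r' : ℝ => (r', z)) (𝓝 r) (𝓝 (r, z)) :=
    (Continuous.prodMk_left z).tendsto r
  have h2 : (fun r' => f r' z) =ᶠ[𝓝 r] fun _ => 0 := h1.eventually (hf.ev hK hr h)
  simp [_root_.pdr, h2.deriv_eq]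

lemma Vs.pdz {K : Set (ℝ × ℝ)} (hK : IsClosed K) {f : ℝ → ℝ → ℝ} (hf : Vs K f) :
    Vs K (pdz f) := by
  intro r z hr h
  have h1 : Tendsto (fun z' : ℝ => (r, z')) (𝓝 z) (𝓝 (r, z)) :=
    (Continuous.prodMk_right r).tendsto z
  have h2 : (fun z' => f r z') =ᶠ[𝓝 z] fun _ => 0 := h1.eventually (hf.ev hK hr h)
  simp [_root_.pdz, h2.deriv_eq]

lemma ibp {K : Set (ℝ × ℝ)} (hK : IsCompact K) {g : ℝ → ℝ → ℝ} (hg : Sm g) (hgK : Vs K g)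
    {χ : ℝ → ℝ} (hχ : ContDiff ℝ (⊤ : ℕ∞) χ) {ε : ℝ} (hε : 0 < ε) (hχ0 : ∀ r < ε, χ r = 0) :
    (IntegrableOn (fun p : ℝ × ℝ => deriv χ p.1 * g p.1 p.2 + χ p.1 * pdr g p.1 p.2) HH ∧
    ∫ p in HH, (deriv χ p.1 * g p.1 p.2 + χ p.1 * pdr g p.1 p.2) = 0) ∧
    (IntegrableOn (fun p : ℝ × ℝ => χ p.1 * pdz g p.1 p.2) HH ∧
    ∫ p in HH, χ p.1 * pdz g p.1 p.2 = 0) := by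
  set G : ℝ × ℝ → ℝ := fun p => χ p.1 * g p.1 p.2 with hGdef
  have hloc : ∀ p : ℝ × ℝ, p.1 < ε → G =ᶠ[𝓝 p] fun _ => 0 := by
    intro p hp
    filter_upwards [(isOpen_lt continuous_fst continuous_const).mem_nhds hp] with q hq
    simp [hGdef, hχ0 q.1 hq]
  have hχ' : Sm (fun r _ => χ r) := (hχ.comp contDiff_fst).contDiffOn
  have hG : ContDiff ℝ (⊤ : ℕ∞) G := by
    rw [contDiff_iff_contDiffAt]
    intro p
    by_cases hp : 0 < p.1
    · exact (hχ'.mul hg).at hp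
    · exact contDiffAt_const.congr_of_eventuallyEq (hloc p (by linarith))
  have hGc : HasCompactSupport G := by
    refine HasCompactSupport.intro hK (fun p hp => ?_)
    by_cases h : 0 < p.1
    · simp [hGdef, hgK p.1 p.2 h hp]
    · simp [hGdef, hχ0 p.1 (by linarith)]
  have hInteg : ∀ v : ℝ × ℝ, Integrable (fun p => fderiv ℝ G p v) := by
    intro v
    refine Continuous.integrable_of_hasCompactSupport ?_ ?_
    · exact (hG.continuous_fderiv (by simp)).clm_apply continuous_const
    · exact hGc.fderiv_apply ℝ v
  have hz : ∀ v : ℝ × ℝ, ∫ p, fderiv ℝ G p v = 0 := by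
    intro v
    have := integral_mul_fderiv_eq_neg_fderiv_mul_of_integrable (𝕜 := ℝ) (μ := volume)
      (f := fun _ : ℝ × ℝ => (1 : ℝ)) (g := G) (v := v) (by simp) (by simpa using hInteg v)
      (by simpa using hG.continuous.integrable_of_hasCompactSupport hGc) (by intros; fun_prop)
      (fun x _ => hG.differentiable (by simp) x)
    simpa using this
  have hoff : ∀ v p, p ∉ HH → fderiv ℝ G p v = 0 := by
    intro v p hp
    have hp : ¬ 0 < p.1 := hp
    rw [(hloc p (by linarith)).fderiv_eq]; simp
  have hz' : ∀ v : ℝ × ℝ, ∫ p in HH, fderiv ℝ G p v = 0 := by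
    intro v
    rw [setIntegral_eq_integral_of_forall_compl_eq_zero (hoff v), hz v]
  have e1 : EqOn (fun p => fderiv ℝ G p (1, 0))
      (fun p : ℝ × ℝ => deriv χ p.1 * g p.1 p.2 + χ p.1 * pdr g p.1 p.2) HH := by
    intro p hp
    have h1 := (hχ'.mul hg).pdr_eq (z := p.2) hp
    have h2 := ((hχ.differentiable (by simp)).differentiableAt.hasDerivAt (x := p.1)).mul
      (hg.dr (z := p.2) hp)
    exact h1.symm.trans h2.deriv
  have e2 : EqOn (fun p => fderiv ℝ G p (0, 1))
      (fun p : ℝ × ℝ => χ p.1 * pdz g p.1 p.2) HH := by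
    intro p hp
    have h1 := (hχ'.mul hg).pdz_eq (z := p.2) hp
    have h2 := (hg.dz (z := p.2) hp).const_mul (χ p.1)
    exact h1.symm.trans h2.deriv
  have hm := HH_open.measurableSet
  refine ⟨⟨(integrableOn_congr_fun e1 hm).1 (hInteg _).integrableOn, ?_⟩,
    ⟨(integrableOn_congr_fun e2 hm).1 (hInteg _).integrableOn, ?_⟩⟩
  · rw [← setIntegral_congr_fun hm e1, hz']
  · rw [← setIntegral_congr_fun hm e2, hz']

lemma kbound : ∃ M : ℝ, 0 ≤ M ∧ ∀ s, |s * deriv Real.smoothTransition (s - 1)| ≤ M := by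
  have hc : Continuous (fun s : ℝ => s * deriv Real.smoothTransition (s - 1)) := by
    have := (Real.smoothTransition.contDiff (n := 1)).continuous_deriv (by simp)
    fun_prop
  have hs : HasCompactSupport (fun s : ℝ => s * deriv Real.smoothTransition (s - 1)) := by
    refine HasCompactSupport.intro (isCompact_Icc (a := (1 : ℝ)) (b := 2)) (fun s h => ?_)
    rw [mem_Icc, not_and_or, not_le, not_le] at h
    rcases h with h | h
    · have : Real.smoothTransition =ᶠ[𝓝 (s - 1)] fun _ => 0 := by
        filter_upwards [Iio_mem_nhds (show s - 1 < 0 by linarith)] with x hx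
        exact Real.smoothTransition.zero_of_nonpos (le_of_lt hx)
      simp [this.deriv_eq]
    · have : Real.smoothTransition =ᶠ[𝓝 (s - 1)] fun _ => 1 := by
        filter_upwards [Ioi_mem_nhds (show 1 < s - 1 by linarith)] with x hx
        exact Real.smoothTransition.one_of_one_le (le_of_lt hx)
      simp [this.deriv_eq]
  obtain ⟨M, hM⟩ := hs.exists_bound_of_continuous hc
  exact ⟨M, (norm_nonneg _).trans (hM 0), hM⟩

lemma kzero {s : ℝ} (h : 2 < s) : s * deriv Real.smoothTransition (s - 1) = 0 := by
  have : Real.smoothTransition =ᶠ[𝓝 (s - 1)] fun _ => 1 := by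
    filter_upwards [Ioi_mem_nhds (show 1 < s - 1 by linarith)] with x hx
    exact Real.smoothTransition.one_of_one_le (le_of_lt hx)
  simp [this.deriv_eq]

lemma sqint_mul {f g : ℝ → ℝ → ℝ} (hf : ContinuousOn (fun p : ℝ × ℝ => f p.1 p.2) HH)
    (hg : ContinuousOn (fun p : ℝ × ℝ => g p.1 p.2) HH)
    (h1 : IntegrableOn (fun p : ℝ × ℝ => f p.1 p.2 ^ 2 * p.1) HH)
    (h2 : IntegrableOn (fun p : ℝ × ℝ => g p.1 p.2 ^ 2 * p.1) HH) :
    IntegrableOn (fun p : ℝ × ℝ => f p.1 p.2 * g p.1 p.2 * p.1) HH := by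
  refine Integrable.mono' (h1.add h2)
    (((hf.mul hg).mul continuous_fst.continuousOn).aestronglyMeasurable HH_open.measurableSet) ?_
  filter_upwards [ae_restrict_mem HH_open.measurableSet] with p hp
  have hp : 0 < p.1 := hp
  simp only [Pi.add_apply, norm_mul, Real.norm_eq_abs, abs_of_pos hp, ← add_mul]
  gcongr
  rw [← abs_mul, abs_le]
  constructor <;> nlinarith [sq_nonneg (f p.1 p.2 + g p.1 p.2), sq_nonneg (f p.1 p.2 - g p.1 p.2),
    sq_nonneg (f p.1 p.2), sq_nonneg (g p.1 p.2)]

lemma key {K : Set (ℝ × ℝ)} (hK : IsCompact K) {f : ℝ → ℝ → ℝ} (hf : Sm f) (hfK : Vs K f)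
    (ha : IntegrableOn (fun p : ℝ × ℝ => pdr (pdr f) p.1 p.2 ^ 2 * p.1) HH)
    (hb : IntegrableOn (fun p : ℝ × ℝ => pdz (pdr f) p.1 p.2 ^ 2 * p.1) HH)
    (hc : IntegrableOn (fun p : ℝ × ℝ => pdz (pdz f) p.1 p.2 ^ 2 * p.1) HH)
    (hq : IntegrableOn (fun p : ℝ × ℝ => (pdr f p.1 p.2 / p.1) ^ 2 * p.1) HH) :
    IntegrableOn (fun p : ℝ × ℝ => pdz (pdz f) p.1 p.2 *
      (pdr (pdr f) p.1 p.2 + pdr f p.1 p.2 / p.1) * p.1) HH ∧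
    ∫ p in HH, pdz (pdz f) p.1 p.2 * (pdr (pdr f) p.1 p.2 + pdr f p.1 p.2 / p.1) * p.1
      = ∫ p in HH, pdz (pdr f) p.1 p.2 ^ 2 * p.1 := by
  have hm := HH_open.measurableSet
  have hca := sqint_mul hf.pdz.pdz.cont hf.pdr.pdr.cont hc ha
  have hcq := sqint_mul (g := fun r z => pdr f r z / r) hf.pdz.pdz.cont hf.pdr.div_r.cont hc hq
  have hcaq : IntegrableOn (fun p : ℝ × ℝ => pdz (pdz f) p.1 p.2 *
      (pdr (pdr f) p.1 p.2 + pdr f p.1 p.2 / p.1) * p.1) HH := by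
    refine (hca.add hcq).congr (Eventually.of_forall fun p => ?_)
    simp only [Pi.add_apply]; ring
  refine ⟨hcaq, ?_⟩
  obtain ⟨M, hM0, hM⟩ := kbound
  set Q : ℝ × ℝ → ℝ := fun p => pdz (pdz f) p.1 p.2 * (pdr f p.1 p.2 / p.1) * p.1 with hQ
  set R : ℝ × ℝ → ℝ := fun p => pdz (pdz f) p.1 p.2 *
      (pdr (pdr f) p.1 p.2 + pdr f p.1 p.2 / p.1) * p.1 - pdz (pdr f) p.1 p.2 ^ 2 * p.1 with hR
  have hRi : IntegrableOn R HH := hcaq.sub hb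
  let S : ℕ → ℝ × ℝ → ℝ := fun n p =>
    (((n : ℝ) + 1) * p.1) * deriv Real.smoothTransition (((n : ℝ) + 1) * p.1 - 1) * Q p
      + Real.smoothTransition (((n : ℝ) + 1) * p.1 - 1) * R p
  have hS0 : ∀ n, ∫ p in HH, S n p = 0 := by
    intro n
    have hn : (0 : ℝ) < (n : ℝ) + 1 := by positivity
    let χ : ℝ → ℝ := fun r => Real.smoothTransition (((n : ℝ) + 1) * r - 1)
    have hχ : ContDiff ℝ (⊤ : ℕ∞) χ :=
      (Real.smoothTransition.contDiff (n := ⊤)).comp (by fun_prop)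
    have hχ0 : ∀ r < 1 / ((n : ℝ) + 1), χ r = 0 := by
      intro r hr
      refine Real.smoothTransition.zero_of_nonpos ?_
      rw [lt_div_iff₀ hn] at hr
      nlinarith
    have hχd : ∀ r, deriv χ r =
        ((n : ℝ) + 1) * deriv Real.smoothTransition (((n : ℝ) + 1) * r - 1) := by
      intro r
      have h1 : HasDerivAt (fun r : ℝ => ((n : ℝ) + 1) * r - 1) ((n : ℝ) + 1) r := by
        simpa using ((hasDerivAt_id r).const_mul ((n : ℝ) + 1)).sub_const 1
      have h2 : HasDerivAt Real.smoothTransition _ (((n : ℝ) + 1) * r - 1) :=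
        ((Real.smoothTransition.contDiff (n := 1)).differentiable (by simp) _).hasDerivAt
      rw [mul_comm]
      exact (h2.comp r h1).deriv
    have hg1 : Sm (fun r z => r * pdr f r z * pdz (pdz f) r z) :=
      (Sm.id.mul hf.pdr).mul hf.pdz.pdz
    have hg2 : Sm (fun r z => r * pdr f r z * pdz (pdr f) r z) :=
      (Sm.id.mul hf.pdr).mul hf.pdr.pdz
    have hv := hfK.pdr hK.isClosed
    have I1 := (ibp hK hg1 (fun r z hr h => by simp [hv r z hr h]) hχ
      (by positivity : 0 < 1 / ((n : ℝ) + 1)) hχ0).1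
    have I2 := (ibp hK hg2 (fun r z hr h => by simp [hv r z hr h]) hχ
      (by positivity : 0 < 1 / ((n : ℝ) + 1)) hχ0).2
    have h3 := integral_sub I1.1 I2.1
    rw [I1.2, I2.2, sub_zero] at h3
    rw [← h3]
    refine setIntegral_congr_fun hm (fun p hp => ?_)
    have hp : 0 < p.1 := hp
    have d1 := (((hasDerivAt_id p.1).mul (hf.pdr.dr (z := p.2) hp)).mul
      (hf.pdz.pdz.dr (z := p.2) hp)).deriv
    have d2 := ((((hf.pdr.dz (z := p.2) hp)).const_mul p.1).mul
      (hf.pdr.pdz.dz (z := p.2) hp)).deriv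
    have d1' : pdr (fun r z => r * pdr f r z * pdz (pdz f) r z) p.1 p.2 = _ := d1
    have d2' : pdz (fun r z => r * pdr f r z * pdz (pdr f) r z) p.1 p.2 = _ := d2
    have c3 : pdz (pdz (pdr f)) p.1 p.2 = pdr (pdz (pdz f)) p.1 p.2 := by
      rw [← hf.pdz.comm hp]
      have : (fun z' => pdz (pdr f) p.1 z') = fun z' => pdr (pdz f) p.1 z' := by
        ext z'; exact hf.comm hp
      simp only [_root_.pdz] at this ⊢
      rw [this]
    simp only [S, hχd, hQ, hR]
    rw [d1', d2', c3]
    simp only [Pi.mul_apply, id, χ]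
    field_simp
    ring
  have hlim : Tendsto (fun n => ∫ p in HH, S n p) atTop (𝓝 (∫ p in HH, R p)) := by
    refine tendsto_integral_of_dominated_convergence (fun p => M * |Q p| + |R p|) ?_ ?_ ?_ ?_
    · intro n
      have h1 : Continuous (fun p : ℝ × ℝ =>
          (((n : ℝ) + 1) * p.1) * deriv Real.smoothTransition (((n : ℝ) + 1) * p.1 - 1)) := by
        have := (Real.smoothTransition.contDiff (n := 1)).continuous_deriv (by simp)
        fun_prop
      have h2 : Continuous (fun p : ℝ × ℝ =>
          Real.smoothTransition (((n : ℝ) + 1) * p.1 - 1)) :=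
        Real.smoothTransition.continuous.comp (by fun_prop)
      exact (h1.aestronglyMeasurable.mul hcq.aestronglyMeasurable).add
        (h2.aestronglyMeasurable.mul hRi.aestronglyMeasurable)
    · exact (hcq.abs.const_mul M).add hRi.abs
    · intro n
      refine Eventually.of_forall fun p => ?_
      refine (norm_add_le _ _).trans ?_
      simp only [Real.norm_eq_abs]
      rw [abs_mul _ (Q p), abs_mul _ (R p)]
      refine add_le_add (mul_le_mul_of_nonneg_right (hM _) (abs_nonneg _)) ?_
      rw [abs_of_nonneg (Real.smoothTransition.nonneg _)]
      exact mul_le_of_le_one_left (abs_nonneg _) (Real.smoothTransition.le_one _)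
    · filter_upwards [ae_restrict_mem hm] with p hp
      have hp : 0 < p.1 := hp
      refine tendsto_const_nhds.congr' ?_
      have ht : Tendsto (fun n : ℕ => ((n : ℝ) + 1) * p.1) atTop atTop :=
        (tendsto_atTop_add_const_right _ _ tendsto_natCast_atTop_atTop).atTop_mul_const hp
      filter_upwards [ht.eventually_gt_atTop 2] with n hn
      simp only [S]
      rw [kzero hn, Real.smoothTransition.one_of_one_le (by linarith)]
      ring
  have h0 : ∫ p in HH, R p = 0 := by
    refine tendsto_nhds_unique hlim ?_
    simp [hS0]
  rw [hR, integral_sub hcaq hb] at h0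
  linarith

lemma dom {F G : ℝ × ℝ → ℝ} (hF : IntegrableOn F HH) (hG : ContinuousOn G HH)
    (h : ∀ p ∈ HH, 0 ≤ G p ∧ G p ≤ F p) : IntegrableOn G HH := by
  refine Integrable.mono' hF (hG.aestronglyMeasurable HH_open.measurableSet) ?_
  filter_upwards [ae_restrict_mem HH_open.measurableSet] with p hp
  rw [Real.norm_eq_abs, abs_of_nonneg (h p hp).1]; exact (h p hp).2

lemma contw {F : ℝ × ℝ → ℝ} (hF : ContinuousOn F HH) : ContinuousOn (fun p => F p * p.1) HH :=
  hF.mul continuous_fst.continuousOn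

lemma vanish_of_pdz {K : Set (ℝ × ℝ)} (hK : IsCompact K) {f : ℝ → ℝ → ℝ} (hf : Sm f)
    (hfK : Vs K f) (h : ∀ r z, 0 < r → pdz f r z = 0) : ∀ r z, 0 < r → f r z = 0 := by
  intro r z hr
  have hconst : ∀ y, f r z = f r y := fun y =>
    is_const_of_deriv_eq_zero (f := fun z' => f r z')
      (fun z' => (hf.dz hr).differentiableAt) (fun z' => h r z' hr) z y
  obtain ⟨M, hM⟩ := hK.isBounded.exists_norm_le
  rw [hconst (M + 1)]
  refine hfK r _ hr (fun hmem => ?_)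
  have h1 := hM _ hmem
  have h2 : ‖M + 1‖ ≤ ‖(r, M + 1)‖ := norm_snd_le (r, M + 1)
  have h3 := le_abs_self (M + 1)
  rw [Real.norm_eq_abs] at h2
  linarith

theorem main_est {K : Set (ℝ × ℝ)} (hK : IsCompact K) {ur u3 : ℝ → ℝ → ℝ}
    (hur : Sm ur) (hu3 : Sm u3) (hurK : Vs K ur) (hu3K : Vs K u3)
    (hdiv : ∀ r z : ℝ, 0 < r → pdr ur r z + ur r z / r + pdz u3 r z = 0)
    (hT : IntegrableOn (fun p : ℝ × ℝ => (hessSq ur p.1 p.2 + hessSq u3 p.1 p.2) * p.1) HH)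
    (C₁ : ℝ)
    (hBS : (∫ p in HH,
          ((pdr (fun r z => ur r z / r) p.1 p.2) ^ 2
            + (pdz (fun r z => ur r z / r) p.1 p.2) ^ 2) * p.1)
        ≤ C₁ ^ 2 * (∫ p in HH, ((pdz ur p.1 p.2 - pdr u3 p.1 p.2) / p.1) ^ 2 * p.1)) :
    (∫ p in HH, (hessSq ur p.1 p.2 + hessSq u3 p.1 p.2) * p.1)
      ≤ (40 + 22 * C₁ ^ 2) * ((∫ p in HH,
              ((pdr (fun r z => pdz ur r z - pdr u3 r z) p.1 p.2) ^ 2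
                + (pdz (fun r z => pdz ur r z - pdr u3 r z) p.1 p.2) ^ 2) * p.1)
            + (∫ p in HH, ((pdz ur p.1 p.2 - pdr u3 p.1 p.2) / p.1) ^ 2 * p.1)) := by
  have hm := HH_open.measurableSet
  set l : ℝ → ℝ → ℝ := pdr (fun r z => ur r z / r) with hl
  set m : ℝ → ℝ → ℝ := pdz (fun r z => ur r z / r) with hmm
  set wr : ℝ → ℝ → ℝ := pdr (fun r z => pdz ur r z - pdr u3 r z) with hwr
  set wz : ℝ → ℝ → ℝ := pdz (fun r z => pdz ur r z - pdr u3 r z) with hwz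
  have sl : Sm l := hur.div_r.pdr
  have sm : Sm m := hur.div_r.pdz
  have swr : Sm wr := (hur.pdz.sub hu3.pdr).pdr
  have swz : Sm wz := (hur.pdz.sub hu3.pdr).pdz
  have sG : Sm (fun r z => (pdz ur r z - pdr u3 r z) / r) := (hur.pdz.sub hu3.pdr).div_r
  -- pointwise identities
  have i1 : ∀ r z, 0 < r → l r z = - pdr (pdr ur) r z - pdr (pdz u3) r z := by
    intro r z hr
    have h1 := ((hur.pdr.dr (z := z) hr).add (hur.div_r.dr (z := z) hr)).add
      (hu3.pdz.dr (z := z) hr)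
    have h2 : HasDerivAt (fun _ : ℝ => (0 : ℝ)) _ r := h1.congr_of_eventuallyEq (by
      filter_upwards [Ioi_mem_nhds hr] with r' hr'
      exact (hdiv r' z hr').symm)
    have h3 := h2.unique (hasDerivAt_const r 0)
    linarith
  have i2 : ∀ r z, 0 < r → m r z = - pdz (pdr ur) r z - pdz (pdz u3) r z := by
    intro r z hr
    have h1 := ((hur.pdr.dz (z := z) hr).add (hur.div_r.dz (z := z) hr)).add
      (hu3.pdz.dz (z := z) hr)
    have h2 : HasDerivAt (fun _ : ℝ => (0 : ℝ)) _ z := h1.congr_of_eventuallyEq (by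
      filter_upwards with z'
      exact (hdiv r z' hr).symm)
    have h3 := h2.unique (hasDerivAt_const z 0)
    linarith
  have i3 : ∀ r z, 0 < r → m r z = pdz ur r z / r := fun r z hr =>
    ((hur.dz (z := z) hr).div_const r).deriv
  have i4 : ∀ r z, 0 < r → wr r z = pdr (pdz ur) r z - pdr (pdr u3) r z := fun r z hr =>
    ((hur.pdz.dr (z := z) hr).sub (hu3.pdr.dr (z := z) hr)).deriv
  have i5 : ∀ r z, 0 < r → wz r z = pdz (pdz ur) r z - pdz (pdr u3) r z := fun r z hr =>
    ((hur.pdz.dz (z := z) hr).sub (hu3.pdr.dz (z := z) hr)).deriv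
  have i6 : ∀ r z, 0 < r → pdz (pdr ur) r z = pdr (pdz ur) r z := fun r z hr => hur.comm hr
  have i7 : ∀ r z, 0 < r → pdz (pdr u3) r z = pdr (pdz u3) r z := fun r z hr => hu3.comm hr
  -- integrability
  have hT8 := hT.const_mul 8
  have hInteg : ∀ f : ℝ → ℝ → ℝ, Sm f →
      (∀ r z, 0 < r → f r z ^ 2 ≤ 8 * (hessSq ur r z + hessSq u3 r z)) →
      IntegrableOn (fun p : ℝ × ℝ => f p.1 p.2 ^ 2 * p.1) HH := by
    intro f hf h
    refine dom hT8 (contw (hf.cont.pow 2)) (fun p hp => ?_)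
    have hp : 0 < p.1 := hp
    refine ⟨by positivity, ?_⟩
    rw [← mul_assoc]
    exact mul_le_mul_of_nonneg_right (h _ _ hp) hp.le
  have ha := hInteg _ hu3.pdr.pdr (fun r z _ => by unfold hessSq; nlinarith only [sq_nonneg (pdr (pdr ur) r z), sq_nonneg (pdz (pdr ur) r z), sq_nonneg (pdr (pdz ur) r z), sq_nonneg (pdz (pdz ur) r z), sq_nonneg (pdr (pdr u3) r z), sq_nonneg (pdz (pdr u3) r z), sq_nonneg (pdr (pdz u3) r z), sq_nonneg (pdz (pdz u3) r z)])
  have hb := hInteg _ hu3.pdr.pdz (fun r z _ => by unfold hessSq; nlinarith only [sq_nonneg (pdr (pdr ur) r z), sq_nonneg (pdz (pdr ur) r z), sq_nonneg (pdr (pdz ur) r z), sq_nonneg (pdz (pdz ur) r z), sq_nonneg (pdr (pdr u3) r z), sq_nonneg (pdz (pdr u3) r z), sq_nonneg (pdr (pdz u3) r z), sq_nonneg (pdz (pdz u3) r z)])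
  have hc := hInteg _ hu3.pdz.pdz (fun r z _ => by unfold hessSq; nlinarith only [sq_nonneg (pdr (pdr ur) r z), sq_nonneg (pdz (pdr ur) r z), sq_nonneg (pdr (pdz ur) r z), sq_nonneg (pdz (pdz ur) r z), sq_nonneg (pdr (pdr u3) r z), sq_nonneg (pdz (pdr u3) r z), sq_nonneg (pdr (pdz u3) r z), sq_nonneg (pdz (pdz u3) r z)])
  have two : ∀ x y : ℝ, (x - y) ^ 2 ≤ 2 * x ^ 2 + 2 * y ^ 2 := fun x y => by
    nlinarith only [sq_nonneg (x + y)]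
  have hlI := hInteg _ sl (fun r z hr => by
    rw [i1 r z hr]; refine (two _ _).trans ?_; unfold hessSq; nlinarith only [sq_nonneg (pdr (pdr ur) r z), sq_nonneg (pdz (pdr ur) r z), sq_nonneg (pdr (pdz ur) r z), sq_nonneg (pdz (pdz ur) r z), sq_nonneg (pdr (pdr u3) r z), sq_nonneg (pdz (pdr u3) r z), sq_nonneg (pdr (pdz u3) r z), sq_nonneg (pdz (pdz u3) r z)])
  have hmI := hInteg _ sm (fun r z hr => by
    rw [i2 r z hr]; refine (two _ _).trans ?_; unfold hessSq; nlinarith only [sq_nonneg (pdr (pdr ur) r z), sq_nonneg (pdz (pdr ur) r z), sq_nonneg (pdr (pdz ur) r z), sq_nonneg (pdz (pdz ur) r z), sq_nonneg (pdr (pdr u3) r z), sq_nonneg (pdz (pdr u3) r z), sq_nonneg (pdr (pdz u3) r z), sq_nonneg (pdz (pdz u3) r z)])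
  have hwrI := hInteg _ swr (fun r z hr => by
    rw [i4 r z hr]; refine (two _ _).trans ?_; unfold hessSq; nlinarith only [sq_nonneg (pdr (pdr ur) r z), sq_nonneg (pdz (pdr ur) r z), sq_nonneg (pdr (pdz ur) r z), sq_nonneg (pdz (pdz ur) r z), sq_nonneg (pdr (pdr u3) r z), sq_nonneg (pdz (pdr u3) r z), sq_nonneg (pdr (pdz u3) r z), sq_nonneg (pdz (pdz u3) r z)])
  have hwzI := hInteg _ swz (fun r z hr => by
    rw [i5 r z hr]; refine (two _ _).trans ?_; unfold hessSq; nlinarith only [sq_nonneg (pdr (pdr ur) r z), sq_nonneg (pdz (pdr ur) r z), sq_nonneg (pdr (pdz ur) r z), sq_nonneg (pdz (pdz ur) r z), sq_nonneg (pdr (pdr u3) r z), sq_nonneg (pdz (pdr u3) r z), sq_nonneg (pdr (pdz u3) r z), sq_nonneg (pdz (pdz u3) r z)])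
  have hD : IntegrableOn (fun p : ℝ × ℝ => (l p.1 p.2 ^ 2 + m p.1 p.2 ^ 2) * p.1) HH := by
    refine (hlI.add hmI).congr (Eventually.of_forall fun p => ?_)
    simp only [Pi.add_apply]; ring
  have hA : IntegrableOn (fun p : ℝ × ℝ => (wr p.1 p.2 ^ 2 + wz p.1 p.2 ^ 2) * p.1) HH := by
    refine (hwrI.add hwzI).congr (Eventually.of_forall fun p => ?_)
    simp only [Pi.add_apply]; ring
  have hAnn : 0 ≤ ∫ p in HH, (wr p.1 p.2 ^ 2 + wz p.1 p.2 ^ 2) * p.1 :=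
    setIntegral_nonneg hm (fun p hp => mul_nonneg (by positivity) (le_of_lt hp))
  -- Γ is integrable
  have hG : IntegrableOn
      (fun p : ℝ × ℝ => ((pdz ur p.1 p.2 - pdr u3 p.1 p.2) / p.1) ^ 2 * p.1) HH := by
    by_contra hG
    rw [integral_undef hG, mul_zero] at hBS
    have hnn : 0 ≤ᵐ[volume.restrict HH]
        fun p : ℝ × ℝ => (l p.1 p.2 ^ 2 + m p.1 p.2 ^ 2) * p.1 := by
      filter_upwards [ae_restrict_mem hm] with p hp
      exact mul_nonneg (by positivity) (le_of_lt hp)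
    have h0 := (integral_eq_zero_iff_of_nonneg_ae hnn hD).1
      (le_antisymm hBS (integral_nonneg_of_ae hnn))
    have hEq := Measure.eqOn_open_of_ae_eq h0 HH_open
      (contw ((sl.cont.pow 2).add (sm.cont.pow 2))) continuousOn_const
    have hm0 : ∀ r z, 0 < r → m r z = 0 := by
      intro r z hr
      have h1 : (l r z ^ 2 + m r z ^ 2) * r = 0 := hEq (show (r, z) ∈ HH from hr)
      have h2 : l r z ^ 2 + m r z ^ 2 = 0 := by
        rcases mul_eq_zero.1 h1 with h | h
        · exact h
        · exact absurd h hr.ne'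
      nlinarith only [sq_nonneg (l r z), sq_nonneg (m r z), h2]
    have hur0 : ∀ r z, 0 < r → ur r z = 0 := vanish_of_pdz hK hur hurK (fun r z hr => by
      have h1 := hm0 r z hr
      rw [i3 r z hr] at h1
      rcases div_eq_zero_iff.1 h1 with h | h
      · exact h
      · exact absurd h hr.ne')
    have hurr : ∀ r z, 0 < r → pdr ur r z = 0 := by
      intro r z hr
      have : (fun r' => ur r' z) =ᶠ[𝓝 r] fun _ => 0 := by
        filter_upwards [Ioi_mem_nhds hr] with r' hr' using hur0 r' z hr'
      simp [pdr, this.deriv_eq]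
    have hu30 : ∀ r z, 0 < r → u3 r z = 0 := vanish_of_pdz hK hu3 hu3K (fun r z hr => by
      have := hdiv r z hr
      rw [hurr r z hr, hur0 r z hr] at this
      simpa using this)
    apply hG
    refine (integrableOn_congr_fun (f := fun _ => (0 : ℝ)) ?_ hm).1 integrableOn_zero
    intro p hp
    have hp : 0 < p.1 := hp
    have e1 : (fun r' => u3 r' p.2) =ᶠ[𝓝 p.1] fun _ => 0 := by
      filter_upwards [Ioi_mem_nhds hp] with r' hr' using hu30 r' _ hr'
    have e2 : pdr u3 p.1 p.2 = 0 := by simp [pdr, e1.deriv_eq]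
    have e3 : pdz ur p.1 p.2 = 0 := by simp [pdz, hur0 _ _ hp]
    simp [e2, e3]
  have i8 : ∀ r z, 0 < r → pdr u3 r z / r = m r z - (pdz ur r z - pdr u3 r z) / r := by
    intro r z hr
    rw [i3 r z hr]; ring
  have hGnn : 0 ≤ ∫ p in HH, ((pdz ur p.1 p.2 - pdr u3 p.1 p.2) / p.1) ^ 2 * p.1 :=
    setIntegral_nonneg hm (fun p hp => mul_nonneg (by positivity) (le_of_lt hp))
  have hq : IntegrableOn (fun p : ℝ × ℝ => (pdr u3 p.1 p.2 / p.1) ^ 2 * p.1) HH := by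
    refine dom ((hmI.const_mul 2).add (hG.const_mul 2)) (contw (hu3.pdr.div_r.cont.pow 2))
      (fun p hp => ?_)
    have hp : 0 < p.1 := hp
    refine ⟨by positivity, ?_⟩
    simp only [Pi.add_apply]
    rw [i8 _ _ hp]
    have := mul_le_mul_of_nonneg_right
      (two (m p.1 p.2) ((pdz ur p.1 p.2 - pdr u3 p.1 p.2) / p.1)) hp.le
    linarith
  obtain ⟨hcaq, hkey⟩ := key hK hu3 hu3K ha hb hc hq
  -- the pointwise estimate
  have hR := (((hA.const_mul 24).add (hD.const_mul 22)).add (hG.const_mul 40)).add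
    ((hb.sub hcaq).const_mul 20)
  have hle := setIntegral_mono_on hT hR hm (fun p hp => by
    have hp : 0 < p.1 := hp
    have hpt : hessSq ur p.1 p.2 + hessSq u3 p.1 p.2 ≤
        24 * (wr p.1 p.2 ^ 2 + wz p.1 p.2 ^ 2) + 22 * (l p.1 p.2 ^ 2 + m p.1 p.2 ^ 2)
        + 40 * ((pdz ur p.1 p.2 - pdr u3 p.1 p.2) / p.1) ^ 2
        + 20 * (pdz (pdr u3) p.1 p.2 ^ 2 - pdz (pdz u3) p.1 p.2 *
          (pdr (pdr u3) p.1 p.2 + pdr u3 p.1 p.2 / p.1)) := by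
      have j1 := i1 p.1 p.2 hp
      have j2 := i2 p.1 p.2 hp
      have j4 := i4 p.1 p.2 hp
      have j5 := i5 p.1 p.2 hp
      have j6 := i6 p.1 p.2 hp
      have j7 := i7 p.1 p.2 hp
      have j8 := i8 p.1 p.2 hp
      unfold hessSq
      rw [j8]
      rw [j6] at j2 ⊢
      rw [j7] at j5 ⊢
      clear j6 j7
      generalize (pdz ur p.1 p.2 - pdr u3 p.1 p.2) / p.1 = G at *
      generalize pdr (pdr u3) p.1 p.2 = a at *
      generalize pdr (pdz u3) p.1 p.2 = b at *
      generalize pdz (pdz u3) p.1 p.2 = c at *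
      generalize l p.1 p.2 = L at *
      generalize m p.1 p.2 = M at *
      generalize wr p.1 p.2 = x at *
      generalize wz p.1 p.2 = y at *
      have k1 : pdr (pdr ur) p.1 p.2 = -b - L := by linarith
      have k2 : pdr (pdz ur) p.1 p.2 = x + a := by linarith
      have k3 : pdz (pdz ur) p.1 p.2 = y + b := by linarith
      have k4 : c = -x - G - (a + (M - G)) := by linarith
      rw [k1, k2, k3]
      have s1 : (-b - L) ^ 2 ≤ 2 * b ^ 2 + 2 * L ^ 2 := by nlinarith only [sq_nonneg (b - L)]
      have s2 : (x + a) ^ 2 ≤ 2 * x ^ 2 + 2 * a ^ 2 := by nlinarith only [sq_nonneg (x - a)]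
      have s3 : (y + b) ^ 2 ≤ 2 * y ^ 2 + 2 * b ^ 2 := by nlinarith only [sq_nonneg (y - b)]
      have s4 : (M - G) ^ 2 ≤ 2 * M ^ 2 + 2 * G ^ 2 := two _ _
      have s5 : a ^ 2 ≤ 2 * (a + (M - G)) ^ 2 + 2 * (M - G) ^ 2 := by
        nlinarith only [sq_nonneg (a + 2 * (M - G))]
      have s6 : (a + (M - G)) ^ 2 + c ^ 2 + 2 * (c * (a + (M - G))) ≤ 2 * x ^ 2 + 2 * G ^ 2 := by
        have : (a + (M - G)) ^ 2 + c ^ 2 + 2 * (c * (a + (M - G))) = (x + G) ^ 2 := by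
          rw [k4]; ring
        rw [this]; nlinarith only [sq_nonneg (x - G)]
      nlinarith only [s1, s2, s3, s4, s5, s6, sq_nonneg x, sq_nonneg y, sq_nonneg L, sq_nonneg M,
        sq_nonneg G, sq_nonneg a, sq_nonneg b, sq_nonneg c]
    refine (mul_le_mul_of_nonneg_right hpt hp.le).trans (le_of_eq ?_)
    simp only [Pi.add_apply, Pi.sub_apply]
    ring : ∀ p ∈ HH, _)
  refine hle.trans ?_
  have e : ∀ {F G : ℝ × ℝ → ℝ}, IntegrableOn F HH → IntegrableOn G HH →
    ∫ p in HH, (F + G) p = (∫ p in HH, F p) + ∫ p in HH, G p := fun hF hG => integral_add hF hG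
  rw [e (((hA.const_mul 24).add (hD.const_mul 22)).add (hG.const_mul 40))
    ((hb.sub hcaq).const_mul 20), e ((hA.const_mul 24).add (hD.const_mul 22)) (hG.const_mul 40),
    e (hA.const_mul 24) (hD.const_mul 22), integral_const_mul, integral_const_mul,
    integral_const_mul, integral_const_mul]
  have e2 := integral_sub hb hcaq
  simp only [Pi.sub_apply]
  rw [e2, hkey]
  nlinarith [mul_nonneg (sq_nonneg C₁) hAnn]

/-- Interpolation bound for the second derivatives of `(u^r, u³)`:
`‖∇̃∇̃(u^r,u³)‖_{L²} ≤ C (‖∇ω^θ‖_{L²} + ‖Γ‖_{L²})`, where `ω^θ = ∂₃u^r − ∂_ru³`,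
`Γ = ω^θ/r`, the `L²` norms being taken on `ℝ³`, i.e. with weight `r dr dx₃`;
the Biot–Savart bound `‖∇̃(u^r/r)‖_{L²} ≤ C₁ ‖Γ‖_{L²}` is assumed as a hypothesis. -/
theorem second_derivatives_interpolation (C₁ : ℝ) (hC₁ : 0 < C₁) :
    ∃ C > (0 : ℝ), ∀ ur uθ u3 : ℝ → ℝ → ℝ,
      ContDiffOn ℝ (⊤ : ℕ∞) (fun p : ℝ × ℝ => ur p.1 p.2) {p : ℝ × ℝ | 0 < p.1} →
      ContDiffOn ℝ (⊤ : ℕ∞) (fun p : ℝ × ℝ => u3 p.1 p.2) {p : ℝ × ℝ | 0 < p.1} →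
      HasCompactSupport (fun p : ℝ × ℝ => ur p.1 p.2) →
      HasCompactSupport (fun p : ℝ × ℝ => u3 p.1 p.2) →
      -- divergence-free condition
      (∀ r z : ℝ, 0 < r → pdr ur r z + ur r z / r + pdz u3 r z = 0) →
      -- `ω^θ` vanishes on the axis
      (∀ z : ℝ, pdz ur 0 z - pdr u3 0 z = 0) →
      -- Biot–Savart estimate `‖∇̃(u^r/r)‖_{L²} ≤ C₁ ‖Γ‖_{L²}`
      ((∫ p in halfPlane,
          ((pdr (fun r z => ur r z / r) p.1 p.2) ^ 2
            + (pdz (fun r z => ur r z / r) p.1 p.2) ^ 2) * p.1) ^ ((1 : ℝ) / 2)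
        ≤ C₁ * (∫ p in halfPlane,
            ((pdz ur p.1 p.2 - pdr u3 p.1 p.2) / p.1) ^ 2 * p.1) ^ ((1 : ℝ) / 2)) →
      (∫ p in halfPlane, (hessSq ur p.1 p.2 + hessSq u3 p.1 p.2) * p.1) ^ ((1 : ℝ) / 2)
        ≤ C * ((∫ p in halfPlane,
              ((pdr (fun r z => pdz ur r z - pdr u3 r z) p.1 p.2) ^ 2
                + (pdz (fun r z => pdz ur r z - pdr u3 r z) p.1 p.2) ^ 2) * p.1)
                  ^ ((1 : ℝ) / 2)
            + (∫ p in halfPlane,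
                ((pdz ur p.1 p.2 - pdr u3 p.1 p.2) / p.1) ^ 2 * p.1) ^ ((1 : ℝ) / 2)) := by
  refine ⟨Real.sqrt (40 + 22 * C₁ ^ 2), Real.sqrt_pos.2 (by positivity), ?_⟩
  intro ur uθ u3 hur hu3 hurc hu3c hdiv _ hBS
  simp only [← Real.sqrt_eq_rpow, halfPlane_eq] at hBS ⊢
  by_cases hT : IntegrableOn
      (fun p : ℝ × ℝ => (hessSq ur p.1 p.2 + hessSq u3 p.1 p.2) * p.1) HH
  swap
  · rw [integral_undef hT, Real.sqrt_zero]
    positivity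
  have hm := HH_open.measurableSet
  have hG : 0 ≤ ∫ p in HH, ((pdz ur p.1 p.2 - pdr u3 p.1 p.2) / p.1) ^ 2 * p.1 :=
    setIntegral_nonneg hm (fun p hp => mul_nonneg (by positivity) (le_of_lt hp))
  have hBS2 := (Real.sqrt_le_left (by positivity)).1 hBS
  rw [mul_pow, Real.sq_sqrt hG] at hBS2
  have hK : IsCompact (tsupport (fun p : ℝ × ℝ => ur p.1 p.2) ∪
      tsupport (fun p : ℝ × ℝ => u3 p.1 p.2)) := hurc.isCompact.union hu3c.isCompact
  have h := main_est hK hur hu3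
    (fun r z _ hn => image_eq_zero_of_notMem_tsupport (f := fun p : ℝ × ℝ => ur p.1 p.2)
      (x := (r, z)) (fun h => hn (Or.inl h)))
    (fun r z _ hn => image_eq_zero_of_notMem_tsupport (f := fun p : ℝ × ℝ => u3 p.1 p.2)
      (x := (r, z)) (fun h => hn (Or.inr h)))
    hdiv hT C₁ hBS2
  refine (Real.sqrt_le_sqrt h).trans ?_
  rw [Real.sqrt_mul (by positivity)]
  refine mul_le_mul_of_nonneg_left ?_ (Real.sqrt_nonneg _)
  have hA : 0 ≤ ∫ p in HH, ((pdr (fun r z => pdz ur r z - pdr u3 r z) p.1 p.2) ^ 2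
      + (pdz (fun r z => pdz ur r z - pdr u3 r z) p.1 p.2) ^ 2) * p.1 :=
    setIntegral_nonneg hm (fun p hp => mul_nonneg (by positivity) (le_of_lt hp))
  rw [Real.sqrt_le_left (by positivity), add_sq, Real.sq_sqrt hA, Real.sq_sqrt hG]
  have := mul_nonneg (Real.sqrt_nonneg (∫ p in HH,
    ((pdr (fun r z => pdz ur r z - pdr u3 r z) p.1 p.2) ^ 2
      + (pdz (fun r z => pdz ur r z - pdr u3 r z) p.1 p.2) ^ 2) * p.1))
    (Real.sqrt_nonneg (∫ p in HH, ((pdz ur p.1 p.2 - pdr u3 p.1 p.2) / p.1) ^ 2 * p.1))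
  linarith
end
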